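/- Rank characterization of rigidity: Let A, B, C be pairwise disjoint finite sets and let V_AB, V_BC be vector spaces on A⊎B and B⊎C over a field F. Then the pair {V_AB, V_BC} is rigid if and only if r(V_AB + V_BC) = r(V_AB) + r(V_BC) and r(V_AB⊥ + V_BC⊥) = r(V_AB⊥) + r(V_BC⊥), where the sums are extended sums on A⊎B⊎C and orthogonal complements are taken within F^{A⊎B} and F^{B⊎C} respectively. -/

import Mathlib

namespace ILA

variable {F : Type*} [Field F]

/-- Restriction of a collection on `X ⊎ Y` to its left component `X`. -/
def restrL {X Y : Type*} (K : Set (X ⊕ Y → F)) : Set (X → F) :=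
  {f | ∃ g : Y → F, Sum.elim f g ∈ K}

/-- Contraction of a collection on `X ⊎ Y` to its left component `X`. -/
def contrL {X Y : Type*} (K : Set (X ⊕ Y → F)) : Set (X → F) :=
  {f | Sum.elim f (0 : Y → F) ∈ K}

/-- Restriction of a collection on `X ⊎ Y` to its right component `Y`. -/
def restrR {X Y : Type*} (K : Set (X ⊕ Y → F)) : Set (Y → F) :=
  {g | ∃ f : X → F, Sum.elim f g ∈ K}

/-- Contraction of a collection on `X ⊎ Y` to its right component `Y`. -/
def contrR {X Y : Type*} (K : Set (X ⊕ Y → F)) : Set (Y → F) :=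
  {g | Sum.elim (0 : X → F) g ∈ K}

/-- Matched composition of a collection on `S ⊎ P` with one on `P ⊎ Q`. -/
def matched {S P Q : Type*} (K₁ : Set (S ⊕ P → F)) (K₂ : Set (P ⊕ Q → F)) :
    Set (S ⊕ Q → F) :=
  {h | ∃ p : P → F, Sum.elim (h ∘ Sum.inl) p ∈ K₁ ∧ Sum.elim p (h ∘ Sum.inr) ∈ K₂}

/-- Skewed composition of a collection on `S ⊎ P` with one on `P ⊎ Q`. -/
def skewed {S P Q : Type*} (K₁ : Set (S ⊕ P → F)) (K₂ : Set (P ⊕ Q → F)) :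
    Set (S ⊕ Q → F) :=
  {h | ∃ p : P → F, Sum.elim (h ∘ Sum.inl) p ∈ K₁ ∧ Sum.elim (-p) (h ∘ Sum.inr) ∈ K₂}

/-- Matched composition of a collection on `S ⊎ P` with one on `P` (i.e. `Q = ∅`). -/
def matchedP {S P : Type*} (K₁ : Set (S ⊕ P → F)) (K₂ : Set (P → F)) : Set (S → F) :=
  {f | ∃ p ∈ K₂, Sum.elim f p ∈ K₁}

/-- Matched composition over the common left component `S` of collections on
`S ⊎ P` and `S ⊎ Q`; the result lives on `P ⊎ Q`. -/
def matchedL {S P Q : Type*} (K₁ : Set (S ⊕ P → F)) (K₂ : Set (S ⊕ Q → F)) :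
    Set (P ⊕ Q → F) :=
  {h | ∃ s : S → F, Sum.elim s (h ∘ Sum.inl) ∈ K₁ ∧ Sum.elim s (h ∘ Sum.inr) ∈ K₂}

/-- The collection of vectors orthogonal (w.r.t. the standard dot product)
to every vector of `K`. -/
def dualSet {X : Type*} [Fintype X] (K : Set (X → F)) : Set (X → F) :=
  {g | ∀ f ∈ K, ∑ x, f x * g x = 0}

/-- The coset `a + K`. -/
def coset {X : Type*} (a : X → F) (K : Set (X → F)) : Set (X → F) :=
  {v | ∃ u ∈ K, v = a + u}

/-- Rank of a collection of vectors: the dimension of its span. -/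
noncomputable def rk {X : Type*} (K : Set (X → F)) : ℕ :=
  Module.finrank F (Submodule.span F K)

/-- `R + L` is everything: the full sum property for a pair of collections on `Y`. -/
def FullSumSets {Y : Type*} (R L : Set (Y → F)) : Prop :=
  ∀ h : Y → F, ∃ u ∈ R, ∃ v ∈ L, h = u + v

/-- The vector on `S ⊎ P ⊎ Q` assembled from its three components. -/
def triple {S P Q : Type*} (f : S → F) (p : P → F) (g : Q → F) : S ⊕ (P ⊕ Q) → F :=
  Sum.elim f (Sum.elim p g)

/-- Extended sum of collections on `S ⊎ P` and `P ⊎ Q`, living on `S ⊎ P ⊎ Q`. -/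
def extSum {S P Q : Type*} (K₁ : Set (S ⊕ P → F)) (K₂ : Set (P ⊕ Q → F)) :
    Set (S ⊕ (P ⊕ Q) → F) :=
  {v | ∃ (f : S → F) (p₁ p₂ : P → F) (g : Q → F),
    Sum.elim f p₁ ∈ K₁ ∧ Sum.elim p₂ g ∈ K₂ ∧ v = triple f (p₁ + p₂) g}

/-- Extended intersection of collections on `S ⊎ P` and `P ⊎ Q`, living on `S ⊎ P ⊎ Q`. -/
def extInter {S P Q : Type*} (K₁ : Set (S ⊕ P → F)) (K₂ : Set (P ⊕ Q → F)) :
    Set (S ⊕ (P ⊕ Q) → F) :=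
  {v | ∃ (f : S → F) (p : P → F) (g : Q → F),
    Sum.elim f p ∈ K₁ ∧ Sum.elim p g ∈ K₂ ∧ v = triple f p g}

/-- Restriction of a collection on `S ⊎ P ⊎ Q` to `S ⊎ Q`. -/
def restrSQ {S P Q : Type*} (K : Set (S ⊕ (P ⊕ Q) → F)) : Set (S ⊕ Q → F) :=
  {w | ∃ p : P → F, triple (w ∘ Sum.inl) p (w ∘ Sum.inr) ∈ K}

/-- Contraction of a collection on `S ⊎ P ⊎ Q` to `S ⊎ Q`. -/
def contrSQ {S P Q : Type*} (K : Set (S ⊕ (P ⊕ Q) → F)) : Set (S ⊕ Q → F) :=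
  {w | triple (w ∘ Sum.inl) (0 : P → F) (w ∘ Sum.inr) ∈ K}

/-- `K_{(−P)Q}`: negate the `P`-components of all vectors of `K`. -/
def negL {P Q : Type*} (K : Set (P ⊕ Q → F)) : Set (P ⊕ Q → F) :=
  {v | Sum.elim (-(v ∘ Sum.inl)) (v ∘ Sum.inr) ∈ K}

/-- Direct sum of collections on `X` and on `Y`, living on `X ⊎ Y`. -/
def dsum {X Y : Type*} (K₁ : Set (X → F)) (K₂ : Set (Y → F)) : Set (X ⊕ Y → F) :=
  {h | h ∘ Sum.inl ∈ K₁ ∧ h ∘ Sum.inr ∈ K₂}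

/-- Matched composition of a collection on `W ⊎ T ⊎ V` with one on `V`,
yielding a collection on `W ⊎ T`. -/
def matchedTriple {W T V : Type*} (K : Set (W ⊕ (T ⊕ V) → F)) (L : Set (V → F)) :
    Set (W ⊕ T → F) :=
  {w | ∃ g ∈ L, Sum.elim (w ∘ Sum.inl) (Sum.elim (w ∘ Sum.inr) g) ∈ K}

/-- Extended sum of a collection on `W ⊎ T ⊎ V` with one on `V`. -/
def extSumV {W T V : Type*} (K : Set (W ⊕ (T ⊕ V) → F)) (L : Set (V → F)) :
    Set (W ⊕ (T ⊕ V) → F) :=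
  {v | ∃ u ∈ K, ∃ g ∈ L, v = u + Sum.elim (0 : W → F) (Sum.elim (0 : T → F) g)}

/-- Extended intersection of a collection on `W ⊎ T ⊎ V` with one on `V`. -/
def extInterV {W T V : Type*} (K : Set (W ⊕ (T ⊕ V) → F)) (L : Set (V → F)) :
    Set (W ⊕ (T ⊕ V) → F) :=
  {v | v ∈ K ∧ (fun x => v (Sum.inr (Sum.inr x))) ∈ L}

/-- Restriction of a collection on `W ⊎ T ⊎ V` to `T`. -/
def restrT {W T V : Type*} (K : Set (W ⊕ (T ⊕ V) → F)) : Set (T → F) :=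
  {t | ∃ (w : W → F) (v : V → F), Sum.elim w (Sum.elim t v) ∈ K}

/-- Contraction of a collection on `W ⊎ T ⊎ V` to `T`. -/
def contrT {W T V : Type*} (K : Set (W ⊕ (T ⊕ V) → F)) : Set (T → F) :=
  {t | Sum.elim (0 : W → F) (Sum.elim t (0 : V → F)) ∈ K}

/-- The image of a collection on `Y ⊎ Y` under the coordinate swap. -/
def swapSet {Y : Type*} (K : Set (Y ⊕ Y → F)) : Set (Y ⊕ Y → F) :=
  (fun v => Sum.elim (v ∘ Sum.inr) (v ∘ Sum.inl)) '' K

/-- A collection on `Y ⊎ Y` is Dirac iff its swap equals its orthogonal complement. -/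
def IsDirac {Y : Type*} [Fintype Y] (K : Set (Y ⊕ Y → F)) : Prop :=
  swapSet K = dualSet K

/-- `T` is column-independent in `K`: the only vector orthogonal to `K` and
supported inside `T` is zero. -/
def ColIndep {X : Type*} [Fintype X] (K : Set (X → F)) (T : Set X) : Prop :=
  ∀ g ∈ dualSet K, (∀ x ∉ T, g x = 0) → g = 0

/-- `T` is a column base of `K`: a column-independent set of size `rk K`. -/
def IsColBase {X : Type*} [Fintype X] (K : Set (X → F)) (T : Set X) : Prop :=
  ColIndep K T ∧ T.ncard = rk K


/-- The orthogonal complement of a collection, as a subspace. -/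
def dualSubmodule {X : Type*} [Fintype X] (K : Set (X → F)) : Submodule F (X → F) where
  carrier := dualSet K
  add_mem' {a b} ha hb f hf := by
    simp [mul_add, Finset.sum_add_distrib, ha f hf, hb f hf]
  zero_mem' f _ := by simp
  smul_mem' c a ha f hf := by
    have h := congrArg (c * ·) (ha f hf)
    simpa [Finset.mul_sum, mul_left_comm] using h

theorem coe_dualSubmodule {X : Type*} [Fintype X] (K : Set (X → F)) :
    (dualSubmodule K : Set (X → F)) = dualSet K := rfl

theorem rk_coe {X : Type*} (V : Submodule F (X → F)) :
    rk (V : Set (X → F)) = Module.finrank F V := by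
  rw [rk, Submodule.span_eq]

/-- Extension by zero from `S ⊎ P` to `S ⊎ P ⊎ Q`. -/
def extendRight (S P Q : Type*) : (S ⊕ P → F) →ₗ[F] (S ⊕ (P ⊕ Q) → F) where
  toFun f := triple (f ∘ Sum.inl) (f ∘ Sum.inr) 0
  map_add' f g := by ext (_ | _ | _) <;> simp [triple]
  map_smul' c f := by ext (_ | _ | _) <;> simp [triple]

/-- Extension by zero from `P ⊎ Q` to `S ⊎ P ⊎ Q`. -/
def extendLeft (S P Q : Type*) : (P ⊕ Q → F) →ₗ[F] (S ⊕ (P ⊕ Q) → F) where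
  toFun f := triple 0 (f ∘ Sum.inl) (f ∘ Sum.inr)
  map_add' f g := by ext (_ | _ | _) <;> simp [triple]
  map_smul' c f := by ext (_ | _ | _) <;> simp [triple]

theorem triple_inj {E S P Q : Type*} {f f' : S → E} {p p' : P → E} {g g' : Q → E} :
    triple f p g = triple f' p' g' ↔ f = f' ∧ p = p' ∧ g = g' := by
  simp [triple, Sum.elim_eq_iff]

theorem extendRight_elim {S P Q : Type*} (f : S → F) (p : P → F) :
    extendRight S P Q (Sum.elim f p) = triple f p 0 := rfl

theorem extendLeft_elim {S P Q : Type*} (p : P → F) (g : Q → F) :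
    extendLeft S P Q (Sum.elim p g) = triple 0 p g := rfl

theorem extendRight_injective (S P Q : Type*) :
    Function.Injective (extendRight (F := F) S P Q) := by
  intro u v h
  obtain ⟨f, p, rfl⟩ : ∃ f p, Sum.elim f p = u := ⟨_, _, Sum.elim_comp_inl_inr u⟩
  obtain ⟨f', p', rfl⟩ : ∃ f p, Sum.elim f p = v := ⟨_, _, Sum.elim_comp_inl_inr v⟩
  simp only [extendRight_elim, triple_inj] at h
  rw [h.1, h.2.1]

theorem extendLeft_injective (S P Q : Type*) :
    Function.Injective (extendLeft (F := F) S P Q) := by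
  intro u v h
  obtain ⟨f, p, rfl⟩ : ∃ f p, Sum.elim f p = u := ⟨_, _, Sum.elim_comp_inl_inr u⟩
  obtain ⟨f', p', rfl⟩ : ∃ f p, Sum.elim f p = v := ⟨_, _, Sum.elim_comp_inl_inr v⟩
  simp only [extendLeft_elim, triple_inj] at h
  rw [h.2.1, h.2.2]

theorem extSum_eq_sup {S P Q : Type*}
    (V₁ : Submodule F (S ⊕ P → F)) (V₂ : Submodule F (P ⊕ Q → F)) :
    extSum (V₁ : Set (S ⊕ P → F)) (V₂ : Set (P ⊕ Q → F)) =
      (V₁.map (extendRight S P Q) ⊔ V₂.map (extendLeft S P Q) : Submodule F _) := by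
  have add_eq (f : S → F) (p₁ p₂ : P → F) (g : Q → F) :
      triple f p₁ 0 + triple 0 p₂ g = triple f (p₁ + p₂) g := by
    ext (_ | _ | _) <;> simp [triple]
  ext v
  rw [SetLike.mem_coe, Submodule.mem_sup]
  constructor
  · rintro ⟨f, p₁, p₂, g, h₁, h₂, rfl⟩
    exact ⟨_, Submodule.mem_map_of_mem h₁, _, Submodule.mem_map_of_mem h₂, add_eq f p₁ p₂ g⟩
  · rintro ⟨_, ⟨u, hu, rfl⟩, _, ⟨w, hw, rfl⟩, rfl⟩
    refine ⟨u ∘ Sum.inl, u ∘ Sum.inr, w ∘ Sum.inl, w ∘ Sum.inr, ?_, ?_, add_eq _ _ _ _⟩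
    · rwa [Sum.elim_comp_inl_inr]
    · rwa [Sum.elim_comp_inl_inr]

theorem map_inf_map_eq_bot_iff {S P Q : Type*}
    (V₁ : Submodule F (S ⊕ P → F)) (V₂ : Submodule F (P ⊕ Q → F)) :
    V₁.map (extendRight S P Q) ⊓ V₂.map (extendLeft S P Q) = ⊥ ↔
      contrR (V₁ : Set (S ⊕ P → F)) ∩ contrL (V₂ : Set (P ⊕ Q → F)) = {0} := by
  constructor
  · intro h
    ext p
    constructor
    · rintro ⟨h₁, h₂⟩
      have hp : triple (0 : S → F) p (0 : Q → F) ∈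
          V₁.map (extendRight S P Q) ⊓ V₂.map (extendLeft S P Q) :=
        ⟨Submodule.mem_map_of_mem h₁, Submodule.mem_map_of_mem h₂⟩
      rw [h, Submodule.mem_bot] at hp
      ext x
      exact congrFun hp (Sum.inr (Sum.inl x))
    · rintro rfl
      simp [contrR, contrL, Sum.elim_zero_zero]
  · intro h
    rw [Submodule.eq_bot_iff]
    rintro _ ⟨⟨u, hu, rfl⟩, ⟨w, hw, hwu⟩⟩
    obtain ⟨f, p, rfl⟩ : ∃ f p, Sum.elim f p = u := ⟨_, _, Sum.elim_comp_inl_inr u⟩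
    obtain ⟨p', g, rfl⟩ : ∃ p g, Sum.elim p g = w := ⟨_, _, Sum.elim_comp_inl_inr w⟩
    rw [extendRight_elim, extendLeft_elim, triple_inj] at hwu
    obtain ⟨rfl, rfl, rfl⟩ := hwu
    have hp : p' ∈ contrR (V₁ : Set (S ⊕ P → F)) ∩ contrL (V₂ : Set (P ⊕ Q → F)) := ⟨hu, hw⟩
    rw [h, Set.mem_singleton_iff] at hp
    rw [hp, Sum.elim_zero_zero, map_zero]

/-- The extended sum has full rank iff the pair has the zero intersection property. -/
theorem rk_extSum_eq_iff {S P Q : Type*} [Finite S] [Finite P] [Finite Q]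
    (V₁ : Submodule F (S ⊕ P → F)) (V₂ : Submodule F (P ⊕ Q → F)) :
    rk (extSum (V₁ : Set (S ⊕ P → F)) (V₂ : Set (P ⊕ Q → F)))
        = Module.finrank F V₁ + Module.finrank F V₂ ↔
      contrR (V₁ : Set (S ⊕ P → F)) ∩ contrL (V₂ : Set (P ⊕ Q → F)) = {0} := by
  rw [extSum_eq_sup, rk_coe, ← map_inf_map_eq_bot_iff, ← Submodule.finrank_eq_zero (R := F)]
  have h := Submodule.finrank_sup_add_finrank_inf_eq
    (V₁.map (extendRight S P Q)) (V₂.map (extendLeft S P Q))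
  rw [(V₁.equivMapOfInjective _ (extendRight_injective S P Q)).symm.finrank_eq,
    (V₂.equivMapOfInjective _ (extendLeft_injective S P Q)).symm.finrank_eq] at h
  omega

theorem eq_top_iff_dualSet_eq {X : Type*} [Fintype X] (W : Submodule F (X → F)) :
    W = ⊤ ↔ dualSet (W : Set (X → F)) = {0} := by
  classical
  constructor
  · rintro rfl
    ext g
    constructor
    · intro hg
      ext x
      simpa [Pi.single_apply] using hg (Pi.single x 1) trivial
    · rintro rfl f _
      simp
  · intro h
    by_contra hW
    obtain ⟨φ, hφ, hle⟩ := W.exists_le_ker_of_lt_top (lt_top_iff_ne_top.2 hW)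
    have hg : (fun x => φ (Pi.single x 1)) ∈ dualSet (W : Set (X → F)) := by
      intro f hf
      rw [← LinearMap.mem_ker.1 (hle hf), LinearMap.pi_apply_eq_sum_univ φ f]
      refine Finset.sum_congr rfl fun x _ => congrArg (f x * φ ·) ?_
      ext j
      simp [Pi.single_apply, eq_comm]
    rw [h, Set.mem_singleton_iff] at hg
    apply hφ
    ext x
    simpa using congrFun hg x

theorem coe_map_inr {X Y : Type*} (V : Submodule F (X ⊕ Y → F)) :
    (V.map (LinearMap.funLeft F F Sum.inr) : Set (Y → F)) =
      restrR (V : Set (X ⊕ Y → F)) := by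
  ext g
  constructor
  · rintro ⟨u, hu, rfl⟩
    exact ⟨u ∘ Sum.inl, by
      rwa [show LinearMap.funLeft F F Sum.inr u = u ∘ Sum.inr from rfl, Sum.elim_comp_inl_inr]⟩
  · rintro ⟨f, hf⟩
    exact ⟨_, hf, rfl⟩

theorem coe_map_inl {X Y : Type*} (V : Submodule F (X ⊕ Y → F)) :
    (V.map (LinearMap.funLeft F F Sum.inl) : Set (X → F)) =
      restrL (V : Set (X ⊕ Y → F)) := by
  ext f
  constructor
  · rintro ⟨u, hu, rfl⟩
    exact ⟨u ∘ Sum.inr, by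
      rwa [show LinearMap.funLeft F F Sum.inl u = u ∘ Sum.inl from rfl, Sum.elim_comp_inl_inr]⟩
  · rintro ⟨g, hg⟩
    exact ⟨_, hg, rfl⟩

theorem contrR_dualSet {X Y : Type*} [Fintype X] [Fintype Y] (K : Set (X ⊕ Y → F)) :
    contrR (dualSet K) = dualSet (restrR K) := by
  ext g
  constructor
  · rintro h p ⟨f, hf⟩
    simpa using h _ hf
  · intro h u hu
    simpa using h (u ∘ Sum.inr) ⟨u ∘ Sum.inl, by rwa [Sum.elim_comp_inl_inr]⟩

theorem contrL_dualSet {X Y : Type*} [Fintype X] [Fintype Y] (K : Set (X ⊕ Y → F)) :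
    contrL (dualSet K) = dualSet (restrL K) := by
  ext g
  constructor
  · rintro h p ⟨f, hf⟩
    simpa using h _ hf
  · intro h u hu
    simpa using h (u ∘ Sum.inl) ⟨u ∘ Sum.inr, by rwa [Sum.elim_comp_inl_inr]⟩

theorem dualSet_sup {X : Type*} [Fintype X] (W₁ W₂ : Submodule F (X → F)) :
    dualSet ((W₁ ⊔ W₂ : Submodule F (X → F)) : Set (X → F)) =
      dualSet (W₁ : Set (X → F)) ∩ dualSet (W₂ : Set (X → F)) := by
  ext g
  constructor
  · exact fun h => ⟨fun f hf => h f (Submodule.mem_sup_left hf),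
      fun f hf => h f (Submodule.mem_sup_right hf)⟩
  · rintro ⟨h₁, h₂⟩ f hf
    obtain ⟨u, hu, v, hv, rfl⟩ := Submodule.mem_sup.1 hf
    simp [add_mul, Finset.sum_add_distrib, h₁ u hu, h₂ v hv]

theorem fullSumSets_coe_iff {Y : Type*} (W₁ W₂ : Submodule F (Y → F)) :
    FullSumSets (W₁ : Set (Y → F)) (W₂ : Set (Y → F)) ↔ W₁ ⊔ W₂ = ⊤ := by
  simp only [FullSumSets, Submodule.eq_top_iff', Submodule.mem_sup, SetLike.mem_coe, eq_comm]

/-- The full sum property is the zero intersection property of the orthogonal complements. -/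
theorem fullSumSets_iff_contr_dualSet {A B C : Type*} [Fintype A] [Fintype B] [Fintype C]
    (V₁ : Submodule F (A ⊕ B → F)) (V₂ : Submodule F (B ⊕ C → F)) :
    FullSumSets (restrR (V₁ : Set (A ⊕ B → F))) (restrL (V₂ : Set (B ⊕ C → F))) ↔
      contrR (dualSet (V₁ : Set (A ⊕ B → F))) ∩ contrL (dualSet (V₂ : Set (B ⊕ C → F)))
        = {0} := by
  rw [contrR_dualSet, contrL_dualSet, ← coe_map_inr, ← coe_map_inl, fullSumSets_coe_iff,
    eq_top_iff_dualSet_eq, dualSet_sup]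

/-- **Rank characterization of rigidity.** The pair `{V₁, V₂}` is rigid iff
`r(V₁ + V₂) = r(V₁) + r(V₂)` and `r(V₁⊥ + V₂⊥) = r(V₁⊥) + r(V₂⊥)`. -/
theorem rigid_iff_rank {A B C : Type*} [Fintype A] [Fintype B] [Fintype C]
    (V₁ : Submodule F (A ⊕ B → F)) (V₂ : Submodule F (B ⊕ C → F)) :
    (FullSumSets (restrR (V₁ : Set (A ⊕ B → F))) (restrL (V₂ : Set (B ⊕ C → F))) ∧
      contrR (V₁ : Set (A ⊕ B → F)) ∩ contrL (V₂ : Set (B ⊕ C → F)) = {0}) ↔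
    (rk (extSum (V₁ : Set (A ⊕ B → F)) (V₂ : Set (B ⊕ C → F)))
        = Module.finrank F V₁ + Module.finrank F V₂ ∧
      rk (extSum (dualSet (V₁ : Set (A ⊕ B → F))) (dualSet (V₂ : Set (B ⊕ C → F))))
        = rk (dualSet (V₁ : Set (A ⊕ B → F))) + rk (dualSet (V₂ : Set (B ⊕ C → F)))) := by
  rw [← coe_dualSubmodule, ← coe_dualSubmodule, rk_coe, rk_coe, rk_extSum_eq_iff,
    rk_extSum_eq_iff, coe_dualSubmodule, coe_dualSubmodule, fullSumSets_iff_contr_dualSet,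
    and_comm]

end ILA
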